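/- Every reflexive Banach space has the Radon–Nikodym property: every Lipschitz function f : ℝ → V into a reflexive Banach space V is differentiable almost everywhere. -/

import Mathlib

open MeasureTheory

/-- A bounded sequence in a reflexive space has a weak cluster point. -/
theorem rnp_weak_cluster
    {V : Type*} [NormedAddCommGroup V] [NormedSpace ℝ V]
    (hrefl : Function.Bijective (NormedSpace.inclusionInDoubleDual ℝ V))
    (C : ℝ) (u : ℕ → V) (hu : ∀ n, ‖u n‖ ≤ C) :
    ∃ g : V, ∀ φ : StrongDual ℝ V, MapClusterPt (φ g) Filter.atTop (fun n => φ (u n)) := by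
  have hc := WeakDual.isCompact_closedBall (𝕜 := ℝ) (E := StrongDual ℝ V) 0 C
  obtain ⟨G, -, hG⟩ := hc.exists_mapClusterPt (f := Filter.atTop)
    (u := fun n => StrongDual.toWeakDual (NormedSpace.inclusionInDoubleDual ℝ V (u n))) (by
      rw [Filter.le_principal_iff, Filter.mem_map]
      refine Filter.Eventually.of_forall fun n => ?_
      simp only [Set.mem_preimage, mem_closedBall_zero_iff]
      exact (NormedSpace.double_dual_bound ℝ V (u n)).trans (hu n))
  obtain ⟨g, hg⟩ := hrefl.2 (WeakDual.toStrongDual G)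
  refine ⟨g, fun φ => ?_⟩
  have h1 := hG.tendsto_comp ((WeakDual.eval_continuous φ).tendsto G)
  have h2 : φ g = G φ := by
    rw [← NormedSpace.dual_def ℝ V g φ, hg]; rfl
  rw [h2]
  exact h1

/-- A separable subspace has a countable family of functionals separating its points. -/
theorem rnp_countable_sep
    {V : Type*} [NormedAddCommGroup V] [NormedSpace ℝ V] (W : Submodule ℝ V)
    [TopologicalSpace.SeparableSpace W] :
    ∃ φ : ℕ → StrongDual ℝ V, ∀ w ∈ W, (∀ n, φ n w = 0) → w = 0 := by
  choose φ h1 h2 using fun n => exists_dual_vector'' ℝ ((TopologicalSpace.denseSeq W n : W) : V)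
  refine ⟨φ, fun w hw h => ?_⟩
  by_contra hne
  have hpos : 0 < ‖w‖ := norm_pos_iff.2 hne
  obtain ⟨n, hn⟩ := (TopologicalSpace.denseRange_denseSeq W).exists_dist_lt (⟨w, hw⟩ : W)
    (half_pos hpos)
  set v : V := ((TopologicalSpace.denseSeq W n : W) : V) with hv
  have hd : ‖v - w‖ < ‖w‖ / 2 := by
    rw [dist_comm, Subtype.dist_eq, dist_eq_norm] at hn
    exact hn
  have h3 : ‖v‖ ≤ ‖v - w‖ := by
    have h4 : φ n (v - w) = ‖v‖ := by
      rw [map_sub, h n, sub_zero]; exact h2 n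
    calc ‖v‖ = φ n (v - w) := h4.symm
      _ ≤ ‖φ n (v - w)‖ := Real.le_norm_self _
      _ ≤ 1 * ‖v - w‖ := (φ n).le_of_opNorm_le (h1 n) _
      _ = _ := one_mul _
  have h5 : ‖w‖ ≤ ‖v‖ + ‖v - w‖ := by
    have := norm_sub_le v (v - w)
    simpa using this
  linarith

/-- Pettis measurability for a function with values in a closed separable subspace. -/
theorem rnp_pettis
    {V : Type*} [NormedAddCommGroup V] [NormedSpace ℝ V] [CompleteSpace V] (W : Submodule ℝ V)
    (hW : IsClosed (W : Set V))
    [TopologicalSpace.SeparableSpace W] (g : ℝ → V) (hg : ∀ x, g x ∈ W)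
    (hm : ∀ φ : StrongDual ℝ V, AEMeasurable (fun x => φ (g x)) volume) :
    AEStronglyMeasurable g volume := by
  obtain ⟨φ, hφ⟩ := rnp_countable_sep W
  have : CompleteSpace W := hW.completeSpace_coe
  have : SecondCountableTopology W := UniformSpace.secondCountable_of_separable W
  letI : MeasurableSpace W := borel W
  have : BorelSpace W := ⟨rfl⟩
  have hcont : Continuous (fun (w : W) (n : ℕ) => φ n (w : V)) := by fun_prop
  have hinj : Function.Injective (fun (w : W) (n : ℕ) => φ n (w : V)) := by
    intro a b hab
    have := hφ ((a : V) - b) (W.sub_mem a.2 b.2) (fun n => by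
      rw [map_sub, sub_eq_zero]; exact congrFun hab n)
    exact Subtype.ext (sub_eq_zero.1 this)
  have hemb := hcont.measurableEmbedding hinj
  let G : ℝ → W := fun x => ⟨g x, hg x⟩
  have hG : AEMeasurable G volume := by
    rw [← hemb.aemeasurable_comp_iff]
    exact aemeasurable_pi_lambda _ (fun n => hm (φ n))
  exact continuous_subtype_val.comp_aestronglyMeasurable hG.aestronglyMeasurable

/-- Every reflexive Banach space has the Radon–Nikodym property:
every Lipschitz function `f : ℝ → V` into a reflexive Banach space `V` is
differentiable almost everywhere.  (Reflexivity is expressed as the canonical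
inclusion of `V` into its double dual being bijective.) -/
theorem reflexive_hasRNP
    {V : Type*} [NormedAddCommGroup V] [NormedSpace ℝ V] [CompleteSpace V]
    (hrefl : Function.Bijective (NormedSpace.inclusionInDoubleDual ℝ V))
    (C : NNReal) (f : ℝ → V) (hf : LipschitzWith C f) :
    ∀ᵐ x : ℝ ∂volume, DifferentiableAt ℝ f x := by
  -- difference quotients
  let e : ℕ → ℝ := fun n => 1 / ((n : ℝ) + 1)
  have he : ∀ n, 0 < e n := fun n => Nat.one_div_pos_of_nat
  have he0 : Filter.Tendsto e Filter.atTop (nhds 0) := tendsto_one_div_add_atTop_nhds_zero_nat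
  let q : ℝ → ℕ → V := fun x n => (e n)⁻¹ • (f (x + e n) - f x)
  have hq : ∀ x n, ‖q x n‖ ≤ C := by
    intro x n
    have h1 : ‖f (x + e n) - f x‖ ≤ C * e n := by
      have := hf.norm_sub_le (x + e n) x
      rwa [add_sub_cancel_left, Real.norm_of_nonneg (he n).le] at this
    simp only [q, norm_smul, norm_inv, Real.norm_of_nonneg (he n).le]
    rw [inv_mul_le_iff₀ (he n), mul_comm]
    exact h1
  choose g hg using fun x => rnp_weak_cluster hrefl C (q x) (hq x)
  -- the separable subspace
  let W : Submodule ℝ V := (Submodule.span ℝ (Set.range f)).topologicalClosure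
  have hWc : IsClosed (W : Set V) := Submodule.isClosed_topologicalClosure _
  have hWs : TopologicalSpace.IsSeparable (W : Set V) := by
    have h1 : TopologicalSpace.IsSeparable (Set.range f) :=
      TopologicalSpace.isSeparable_range hf.continuous
    exact (h1.span (R := ℝ)).closure
  have : TopologicalSpace.SeparableSpace W := hWs.separableSpace
  have hfW : ∀ x, f x ∈ W := fun x =>
    Submodule.le_topologicalClosure _ (Submodule.subset_span ⟨x, rfl⟩)
  have hqW : ∀ x n, q x n ∈ W := fun x n =>
    W.smul_mem _ (W.sub_mem (hfW _) (hfW _))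
  have hgW : ∀ x, g x ∈ W := by
    intro x
    by_contra hx
    obtain ⟨l, s, h1, h2⟩ := geometric_hahn_banach_closed_point W.convex hWc hx
    have : l (g x) ∈ Set.Iic s := isClosed_Iic.mem_of_mapClusterPt (hg x l)
      (Filter.Eventually.of_forall fun n => (h1 _ (hqW x n)).le)
    exact absurd this (not_le.2 h2)
  have hgC : ∀ x, ‖g x‖ ≤ C := by
    intro x
    obtain ⟨l, h1, h2⟩ := exists_dual_vector'' ℝ (g x)
    have : l (g x) ∈ Set.Iic (C : ℝ) := isClosed_Iic.mem_of_mapClusterPt (hg x l)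
      (Filter.Eventually.of_forall fun n => by
        calc l (q x n) ≤ ‖l (q x n)‖ := Real.le_norm_self _
          _ ≤ 1 * ‖q x n‖ := l.le_of_opNorm_le h1 _
          _ ≤ C := by rw [one_mul]; exact hq x n)
    rw [h2] at this
    exact this
  have hφL : ∀ φ : StrongDual ℝ V, LipschitzWith (‖φ‖₊ * C) (fun x => φ (f x)) :=
    fun φ => φ.lipschitz.comp hf
  have hder : ∀ φ : StrongDual ℝ V,
      (fun x => φ (g x)) =ᵐ[volume] deriv (fun x => φ (f x)) := by
    intro φ
    filter_upwards [(hφL φ).ae_differentiableAt_real] with x hx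
    have h1 := hx.hasDerivAt.tendsto_slope_zero.comp
      (tendsto_nhdsWithin_iff.2 ⟨he0, Filter.Eventually.of_forall fun n => (he n).ne'⟩)
    have h2 : Filter.Tendsto (fun n => φ (q x n)) Filter.atTop
        (nhds (deriv (fun x => φ (f x)) x)) := by
      refine h1.congr fun n => ?_
      simp [q]
    have h3 : ClusterPt (φ (g x)) (nhds (deriv (fun x => φ (f x)) x)) :=
      ClusterPt.mono (hg x φ) h2
    exact eq_of_nhds_neBot h3
  have hmeas : AEStronglyMeasurable g volume :=
    rnp_pettis W hWc g hgW fun φ => (measurable_deriv _).aemeasurable.congr (hder φ).symm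
  have hloc : LocallyIntegrable g volume :=
    (locallyIntegrable_const (C : ℝ)).mono hmeas (Filter.Eventually.of_forall fun x => by
      simpa using hgC x)
  have hint : ∀ a b : ℝ, IntervalIntegrable g volume a b := fun a b =>
    intervalIntegrable_iff.mpr <|
      (hloc.integrableOn_isCompact isCompact_uIcc).mono_set Set.uIoc_subset_uIcc
  have hrep : f = fun x => f 0 + ∫ t in (0 : ℝ)..x, g t := by
    funext x
    rw [SeparatingDual.eq_iff_forall_dual_eq (R := ℝ)]
    intro φ
    have h1 : (∫ t in (0 : ℝ)..x, φ (g t)) = ∫ t in (0 : ℝ)..x, deriv (fun x => φ (f x)) t :=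
      intervalIntegral.integral_congr_ae ((hder φ).mono fun t ht _ => ht)
    have h2 := ((hφL φ).lipschitzOnWith
      (s := Set.uIcc 0 x)).absolutelyContinuousOnInterval.integral_deriv_eq_sub
    rw [map_add, ← φ.intervalIntegral_comp_comm (hint 0 x), h1, h2]
    ring
  filter_upwards [_root_.LocallyIntegrable.ae_hasDerivAt_integral hloc] with x hx
  rw [hrep]
  exact ((hx 0).const_add (f 0)).differentiableAt
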